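/- Let ν ∈ (−1/2, 0) ∪ (0, 1). Then there exists a unique x_ν ∈ (0, ∞) such that G_{ν,2}(x)·G′_{ν,1}(x)/G′_{ν,2}(x) − G_{ν,1}(x) is strictly positive for 0 < x < x_ν, zero at x = x_ν, and strictly negative for x > x_ν; consequently the function x ↦ G_{ν,1}(x)/G_{ν,2}(x) is strictly increasing on (0, x_ν), strictly decreasing on (x_ν, ∞), and C_ν = sup_{x>0} G_{ν,1}(x)/G_{ν,2}(x) = G_{ν,1}(x_ν)/G_{ν,2}(x_ν), with x_ν satisfying G_{ν,1}(x_ν)/G_{ν,2}(x_ν) = G′_{ν,1}(x_ν)/G′_{ν,2}(x_ν). -/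

import Mathlib

/-- Numerator `G_{ν,1}` of the one-variable quotient. -/
noncomputable def G1 (ν x : ℝ) : ℝ :=
  3 * Real.log (1 + x/3) - Real.log (1 + (1+2*ν)*x/3) - 2 * Real.log (1 + (1-ν)*x/3)

/-- Denominator `G_{ν,2}` of the one-variable quotient (independent of `ν`). -/
noncomputable def G2 (x : ℝ) : ℝ :=
  3 * Real.log (1 + x/3) - Real.log (1 + x)

/-- The quotient of the derivatives of `G_{ν,1}` and `G_{ν,2}`, in closed form. -/
noncomputable def derivRatio (ν x : ℝ) : ℝ :=
  ν ^ 2 * (1 + x) / ((1 + (1+2*ν)*x/3) * (1 + (1-ν)*x/3))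

theorem one_add_mul_div_pos {a x : ℝ} (ha : 0 ≤ a) (hx : 0 ≤ x) : 0 < 1 + a * x / 3 := by
  positivity

theorem hasDerivAt_log_one_add_mul_div {a x : ℝ} (h : 0 < 1 + a * x / 3) :
    HasDerivAt (fun y => Real.log (1 + a * y / 3)) (a / 3 / (1 + a * x / 3)) x := by
  have h1 : HasDerivAt (fun y : ℝ => 1 + a * y / 3) (a / 3) x := by
    simpa using (((hasDerivAt_id x).const_mul a).div_const 3).const_add 1
  exact h1.log h.ne'

theorem hasDerivAt_G2 {x : ℝ} (hx : 0 ≤ x) :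
    HasDerivAt G2 (2 * x / 3 / ((1 + x / 3) * (1 + x))) x := by
  have h1 : 0 < 1 + (1 : ℝ) * x / 3 := by positivity
  have h3 : 0 < 1 + (3 : ℝ) * x / 3 := by positivity
  have h := ((hasDerivAt_log_one_add_mul_div h1).const_mul 3).sub
    (hasDerivAt_log_one_add_mul_div h3)
  refine (h.congr_deriv ?_).congr_of_eventuallyEq (.of_forall fun y => ?_)
  · field_simp
    ring
  · simp only [G2, Pi.sub_apply]
    congr 4 <;> ring

theorem hasDerivAt_G1 {ν x : ℝ} (hν1 : -1/2 < ν) (hν2 : ν < 1) (hx : 0 ≤ x) :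
    HasDerivAt (G1 ν) (2 * ν ^ 2 * x / 3 /
      ((1 + x / 3) * ((1 + (1+2*ν)*x/3) * (1 + (1-ν)*x/3)))) x := by
  have h1 : 0 < 1 + (1 : ℝ) * x / 3 := by positivity
  have ha := one_add_mul_div_pos (a := 1 + 2 * ν) (by linarith) hx
  have hb := one_add_mul_div_pos (a := 1 - ν) (by linarith) hx
  have h := (((hasDerivAt_log_one_add_mul_div h1).const_mul 3).sub
    (hasDerivAt_log_one_add_mul_div ha)).sub ((hasDerivAt_log_one_add_mul_div hb).const_mul 2)
  refine (h.congr_deriv ?_).congr_of_eventuallyEq (.of_forall fun y => ?_)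
  · have h1' : 0 < 1 + x / 3 := by positivity
    rw [one_mul, eq_div_iff (by positivity)]
    generalize hA : 1 + (1+2*ν)*x/3 = A at *
    generalize hB : 1 + (1-ν)*x/3 = B at *
    generalize hT : 1 + x / 3 = T at *
    field_simp
    subst hA hB hT
    ring
  · simp only [G1, Pi.sub_apply, one_mul]

theorem strictMonoOn_Ici_of_hasDerivAt_pos {f f' : ℝ → ℝ} {a : ℝ}
    (hf : ∀ x, a ≤ x → HasDerivAt f (f' x) x) (hf' : ∀ x, a < x → 0 < f' x) :
    StrictMonoOn f (Set.Ici a) := by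
  refine strictMonoOn_of_deriv_pos (convex_Ici a)
    (fun x hx => (hf x hx).continuousAt.continuousWithinAt) fun x hx => ?_
  rw [interior_Ici] at hx
  rw [(hf x (le_of_lt hx)).deriv]
  exact hf' x hx

theorem G2_pos {x : ℝ} (hx : 0 < x) : 0 < G2 x := by
  have h := strictMonoOn_Ici_of_hasDerivAt_pos (fun x hx => hasDerivAt_G2 hx)
    (fun x hx => by positivity) (Set.self_mem_Ici (a := (0 : ℝ))) hx.le hx
  simpa [G2] using h

theorem strictMonoOn_G1 {ν : ℝ} (hν1 : -1/2 < ν) (hν2 : ν < 1) (hν0 : ν ≠ 0) :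
    StrictMonoOn (G1 ν) (Set.Ici 0) := by
  refine strictMonoOn_Ici_of_hasDerivAt_pos (fun x hx => hasDerivAt_G1 hν1 hν2 hx) fun x hx => ?_
  have ha := one_add_mul_div_pos (a := 1 + 2 * ν) (by linarith) hx.le
  have hb := one_add_mul_div_pos (a := 1 - ν) (by linarith) hx.le
  positivity

theorem deriv_G1_div_deriv_G2 {ν x : ℝ} (hν1 : -1/2 < ν) (hν2 : ν < 1) (hx : 0 < x) :
    deriv (G1 ν) x / deriv G2 x = derivRatio ν x := by
  have ha := one_add_mul_div_pos (a := 1 + 2 * ν) (by linarith) hx.le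
  have hb := one_add_mul_div_pos (a := 1 - ν) (by linarith) hx.le
  rw [(hasDerivAt_G1 hν1 hν2 hx.le).deriv, (hasDerivAt_G2 hx.le).deriv, derivRatio]
  have h1 : 0 < 1 + x / 3 := by positivity
  have h2 : 0 < 1 + x := by positivity
  generalize 1 + (1+2*ν)*x/3 = A at *
  generalize 1 + (1-ν)*x/3 = B at *
  generalize 1 + x / 3 = T at *
  generalize 1 + x = S at *
  field_simp

theorem hasDerivAt_derivRatio {ν x : ℝ} (hν1 : -1/2 < ν) (hν2 : ν < 1) (hx : 0 ≤ x) :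
    HasDerivAt (derivRatio ν) (ν ^ 2 * (1 - ν) * (3 - 2 * (1+2*ν) * x - (1+2*ν) * x ^ 2) / 9 /
      ((1 + (1+2*ν)*x/3) * (1 + (1-ν)*x/3)) ^ 2) x := by
  have ha := one_add_mul_div_pos (a := 1 + 2 * ν) (by linarith) hx
  have hb := one_add_mul_div_pos (a := 1 - ν) (by linarith) hx
  have hlin : ∀ a : ℝ, HasDerivAt (fun y : ℝ => 1 + a * y / 3) (a / 3) x := fun a => by
    simpa using (((hasDerivAt_id x).const_mul a).div_const 3).const_add 1
  have hnum : HasDerivAt (fun y : ℝ => ν ^ 2 * (1 + y)) (ν ^ 2) x := by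
    simpa using ((hasDerivAt_id x).const_add 1).const_mul (ν ^ 2)
  refine (hnum.div ((hlin (1 + 2 * ν)).mul (hlin (1 - ν))) (mul_pos ha hb).ne').congr_deriv ?_
  simp only [Pi.mul_apply]
  congr 1
  ring

/-- `G_{ν,2}` times the quotient of derivatives, minus `G_{ν,1}`. -/
noncomputable def auxH (ν x : ℝ) : ℝ := G2 x * derivRatio ν x - G1 ν x

theorem hasDerivAt_auxH {ν x : ℝ} (hν1 : -1/2 < ν) (hν2 : ν < 1) (hx : 0 ≤ x) :
    HasDerivAt (auxH ν) (G2 x * (ν ^ 2 * (1 - ν) * (3 - 2 * (1+2*ν) * x - (1+2*ν) * x ^ 2) / 9 /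
      ((1 + (1+2*ν)*x/3) * (1 + (1-ν)*x/3)) ^ 2)) x := by
  have ha := one_add_mul_div_pos (a := 1 + 2 * ν) (by linarith) hx
  have hb := one_add_mul_div_pos (a := 1 - ν) (by linarith) hx
  refine (((hasDerivAt_G2 hx).mul (hasDerivAt_derivRatio hν1 hν2 hx)).sub
    (hasDerivAt_G1 hν1 hν2 hx)).congr_deriv ?_
  rw [add_sub_right_comm, add_eq_right, sub_eq_zero, derivRatio]
  have h1 : 0 < 1 + x / 3 := by positivity
  have h2 : 0 < 1 + x := by positivity
  generalize 1 + (1+2*ν)*x/3 = A at *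
  generalize 1 + (1-ν)*x/3 = B at *
  generalize 1 + x / 3 = T at *
  generalize 1 + x = S at *
  field_simp

theorem exists_auxH_neg {ν : ℝ} (hν1 : -1/2 < ν) (hν2 : ν < 1) (hν0 : ν ≠ 0) (N : ℝ) :
    ∃ M, N < M ∧ auxH ν M < 0 := by
  have ha : 0 < 1 + 2 * ν := by linarith
  have hb : 0 < 1 - ν := by linarith
  have hmono := strictMonoOn_G1 hν1 hν2 hν0
  have hG : 0 < G1 ν 1 := by
    simpa [G1] using hmono (Set.self_mem_Ici (a := (0 : ℝ))) (Set.mem_Ici.2 zero_le_one) one_pos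
  have hν := sq_pos_of_ne_zero hν0
  set ε := G1 ν 1 * ((1 + 2 * ν) * (1 - ν)) / (108 * ν ^ 2) with hε
  have hε0 : 0 < ε := by positivity
  obtain ⟨y, hy, hyN⟩ := ((Real.isLittleO_log_id_atTop.bound hε0).and
    (Filter.eventually_gt_atTop (max N 1 + 1))).exists
  have hyN' : N < y - 1 := by linarith [le_max_left N 1]
  have hy1 : 1 < y - 1 := by linarith [le_max_right N 1]
  refine ⟨y - 1, hyN', ?_⟩
  have hlog : Real.log y ≤ ε * y := by
    have h0 : 0 ≤ y := by linarith
    simpa [abs_of_nonneg h0] using (le_abs_self _).trans hy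
  have hx : 0 < y - 1 := by linarith
  have hG1 : G1 ν 1 < G1 ν (y - 1) := hmono (Set.mem_Ici.2 zero_le_one) (Set.mem_Ici.2 hx.le) hy1
  have hG2 : G2 (y - 1) ≤ 2 * (ε * y) := by
    have : Real.log (1 + (y - 1) / 3) ≤ Real.log y :=
      Real.log_le_log (by positivity) (by linarith)
    simp only [G2, add_sub_cancel]
    linarith
  have hR : derivRatio ν (y - 1) * y ≤ 36 * ν ^ 2 / ((1 + 2 * ν) * (1 - ν)) := by
    have hA := one_add_mul_div_pos ha.le hx.le
    have hB := one_add_mul_div_pos hb.le hx.le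
    rw [derivRatio, div_mul_eq_mul_div, div_le_div_iff₀ (by positivity) (by positivity)]
    have hAB : (1 + 2 * ν) * (1 - ν) * y ^ 2 ≤
        36 * ((1 + (1+2*ν)*(y - 1)/3) * (1 + (1-ν)*(y - 1)/3)) := by
      have h1 : (1 + 2 * ν) * y ≤ 6 * (1 + (1+2*ν)*(y - 1)/3) := by nlinarith
      have h2 : (1 - ν) * y ≤ 6 * (1 + (1-ν)*(y - 1)/3) := by nlinarith
      have h3 : 0 ≤ (1 - ν) * y := by nlinarith
      calc _ = ((1 + 2 * ν) * y) * ((1 - ν) * y) := by ring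
        _ ≤ _ := mul_le_mul h1 h2 h3 (by positivity)
        _ = _ := by ring
    calc _ = ν ^ 2 * ((1 + 2 * ν) * (1 - ν) * y ^ 2) := by ring
      _ ≤ _ := mul_le_mul_of_nonneg_left hAB hν.le
      _ = _ := by ring
  have hR0 : 0 ≤ derivRatio ν (y - 1) := by
    have hA := one_add_mul_div_pos ha.le hx.le
    have hB := one_add_mul_div_pos hb.le hx.le
    unfold derivRatio
    positivity
  have hprod : G2 (y - 1) * derivRatio ν (y - 1) ≤ G1 ν 1 := by
    calc _ ≤ 2 * (ε * y) * derivRatio ν (y - 1) := mul_le_mul_of_nonneg_right hG2 hR0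
      _ = 2 * ε * (derivRatio ν (y - 1) * y) := by ring
      _ ≤ 2 * ε * (36 * ν ^ 2 / ((1 + 2 * ν) * (1 - ν))) := by gcongr
      _ = 2 / 3 * G1 ν 1 := by rw [hε]; field_simp; norm_num
      _ ≤ _ := by linarith
  unfold auxH
  linarith

theorem exists_auxH_sign_change {ν : ℝ} (hν1 : -1/2 < ν) (hν2 : ν < 1) (hν0 : ν ≠ 0) :
    ∃ c, 0 < c ∧ (∀ x, 0 < x → x < c → 0 < auxH ν x) ∧ auxH ν c = 0 ∧
      ∀ x, c < x → auxH ν x < 0 := by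
  have ha : 0 < 1 + 2 * ν := by linarith
  have hb : 0 < 1 - ν := by linarith
  have hν := sq_pos_of_ne_zero hν0
  set r := √(1 + 3 / (1 + 2 * ν)) - 1 with hr
  have hs : (r + 1) ^ 2 = 1 + 3 / (1 + 2 * ν) := by
    rw [hr, sub_add_cancel, Real.sq_sqrt (by positivity)]
  have hr0 : 0 < r := by
    rw [hr, sub_pos, Real.lt_sqrt zero_le_one, one_pow]
    exact lt_add_of_pos_right 1 (by positivity)
  have hquad : ∀ x, 3 - 2 * (1+2*ν) * x - (1+2*ν) * x ^ 2 =
      (1 + 2 * ν) * ((r - x) * (r + x + 2)) := fun x => by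
    have : (r - x) * (r + x + 2) = (r + 1) ^ 2 - (x + 1) ^ 2 := by ring
    rw [this, hs]
    field_simp
    ring
  have hcont : ContinuousOn (auxH ν) (Set.Ici 0) := fun x hx =>
    (hasDerivAt_auxH hν1 hν2 hx).continuousAt.continuousWithinAt
  have hmono : StrictMonoOn (auxH ν) (Set.Icc 0 r) := by
    refine strictMonoOn_of_deriv_pos (convex_Icc 0 r) (hcont.mono Set.Icc_subset_Ici_self)
      fun x hx => ?_
    rw [interior_Icc] at hx
    rw [(hasDerivAt_auxH hν1 hν2 hx.1.le).deriv, hquad]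
    have h0 := hx.1
    have hA := one_add_mul_div_pos ha.le h0.le
    have hB := one_add_mul_div_pos hb.le h0.le
    have h1 : 0 < r - x := sub_pos.2 hx.2
    have h2 := G2_pos h0
    positivity
  have hanti : StrictAntiOn (auxH ν) (Set.Ici r) := by
    refine strictAntiOn_of_deriv_neg (convex_Ici r) (hcont.mono (Set.Ici_subset_Ici.2 hr0.le))
      fun x hx => ?_
    rw [interior_Ici] at hx
    have h0 : 0 < x := hr0.trans hx
    rw [(hasDerivAt_auxH hν1 hν2 h0.le).deriv, hquad, ← neg_sub x r]
    have hA := one_add_mul_div_pos ha.le h0.le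
    have hB := one_add_mul_div_pos hb.le h0.le
    have h1 : 0 < x - r := sub_pos.2 hx
    have h2 := G2_pos h0
    simp only [neg_mul, mul_neg, neg_div, Left.neg_neg_iff]
    positivity
  have hzero : auxH ν 0 = 0 := by simp [auxH, G1, G2]
  have hpos : ∀ x, 0 < x → x ≤ r → 0 < auxH ν x := fun x hx hxr => by
    simpa [hzero] using hmono (Set.left_mem_Icc.2 hr0.le) ⟨hx.le, hxr⟩ hx
  obtain ⟨M, hM, hMneg⟩ := exists_auxH_neg hν1 hν2 hν0 r
  obtain ⟨c, hc, hc0⟩ := intermediate_value_Icc' hM.le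
    (hcont.mono fun x hx => hr0.le.trans hx.1) ⟨hMneg.le, (hpos r hr0 le_rfl).le⟩
  refine ⟨c, hr0.trans_le hc.1, fun x hx hxc => ?_, hc0, fun x hx => ?_⟩
  · rcases le_total x r with h | h
    · exact hpos x hx h
    · exact hc0 ▸ hanti h hc.1 hxc
  · exact hc0 ▸ hanti hc.1 (hc.1.trans hx.le) hx

theorem hasDerivAt_G1_div_G2 {ν x : ℝ} (hν1 : -1/2 < ν) (hν2 : ν < 1) (hx : 0 < x) :
    HasDerivAt (fun x => G1 ν x / G2 x)
      (2 * x / 3 / ((1 + x / 3) * (1 + x)) / G2 x ^ 2 * auxH ν x) x := by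
  have ha := one_add_mul_div_pos (a := 1 + 2 * ν) (by linarith) hx.le
  have hb := one_add_mul_div_pos (a := 1 - ν) (by linarith) hx.le
  refine ((hasDerivAt_G1 hν1 hν2 hx.le).div (hasDerivAt_G2 hx.le) (G2_pos hx).ne').congr_deriv ?_
  rw [auxH, derivRatio]
  have h1 : 0 < 1 + x / 3 := by positivity
  have h2 : 0 < 1 + x := by positivity
  generalize 1 + (1+2*ν)*x/3 = A at *
  generalize 1 + (1-ν)*x/3 = B at *
  generalize 1 + x / 3 = T at *
  generalize 1 + x = S at *
  field_simp

theorem stmt_18 (ν : ℝ) (hν1 : -1/2 < ν) (hν2 : ν < 1) (hν0 : ν ≠ 0) :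
    ∃ xν : ℝ, 0 < xν ∧
      (∀ x : ℝ, 0 < x → x < xν →
        0 < G2 x * (deriv (G1 ν) x / deriv G2 x) - G1 ν x) ∧
      (G2 xν * (deriv (G1 ν) xν / deriv G2 xν) - G1 ν xν = 0) ∧
      (∀ x : ℝ, xν < x →
        G2 x * (deriv (G1 ν) x / deriv G2 x) - G1 ν x < 0) ∧
      (∀ x' : ℝ, 0 < x' →
        G2 x' * (deriv (G1 ν) x' / deriv G2 x') - G1 ν x' = 0 → x' = xν) ∧
      StrictMonoOn (fun x => G1 ν x / G2 x) (Set.Ioo 0 xν) ∧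
      StrictAntiOn (fun x => G1 ν x / G2 x) (Set.Ioi xν) ∧
      sSup {y : ℝ | ∃ x : ℝ, 0 < x ∧ y = G1 ν x / G2 x} = G1 ν xν / G2 xν ∧
      G1 ν xν / G2 xν = deriv (G1 ν) xν / deriv G2 xν := by
  obtain ⟨c, hc, hpos, hzero, hneg⟩ := exists_auxH_sign_change hν1 hν2 hν0
  have haux : ∀ x, 0 < x → G2 x * (deriv (G1 ν) x / deriv G2 x) - G1 ν x = auxH ν x :=
    fun x hx => by rw [deriv_G1_div_deriv_G2 hν1 hν2 hx, auxH]
  have hcont : ContinuousOn (fun x => G1 ν x / G2 x) (Set.Ioi 0) := fun x hx =>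
    (hasDerivAt_G1_div_G2 hν1 hν2 hx).continuousAt.continuousWithinAt
  have hmono : StrictMonoOn (fun x => G1 ν x / G2 x) (Set.Ioc 0 c) := by
    refine strictMonoOn_of_deriv_pos (convex_Ioc 0 c) (hcont.mono fun x hx => hx.1)
      fun x hx => ?_
    rw [interior_Ioc] at hx
    have h0 := hx.1
    rw [(hasDerivAt_G1_div_G2 hν1 hν2 h0).deriv]
    have h1 := hpos x h0 hx.2
    have h2 := G2_pos h0
    positivity
  have hanti : StrictAntiOn (fun x => G1 ν x / G2 x) (Set.Ici c) := by
    refine strictAntiOn_of_deriv_neg (convex_Ici c) (hcont.mono fun x hx => hc.trans_le hx)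
      fun x hx => ?_
    rw [interior_Ici] at hx
    have h0 : 0 < x := hc.trans hx
    rw [(hasDerivAt_G1_div_G2 hν1 hν2 h0).deriv]
    have h2 := G2_pos h0
    exact mul_neg_of_pos_of_neg (by positivity) (hneg x hx)
  refine ⟨c, hc, fun x hx hxc => haux x hx ▸ hpos x hx hxc, haux c hc ▸ hzero,
    fun x hx => haux x (hc.trans hx) ▸ hneg x hx, fun x hx h => ?_,
    hmono.mono Set.Ioo_subset_Ioc_self, hanti.mono Set.Ioi_subset_Ici_self, ?_, ?_⟩
  · rw [haux x hx] at h
    rcases lt_trichotomy x c with hlt | heq | hgt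
    · exact absurd h (hpos x hx hlt).ne'
    · exact heq
    · exact absurd h (hneg x hgt).ne
  · refine IsGreatest.csSup_eq ⟨⟨c, hc, rfl⟩, ?_⟩
    rintro _ ⟨x, hx, rfl⟩
    rcases le_total x c with h | h
    · exact hmono.monotoneOn ⟨hx, h⟩ ⟨hc, le_rfl⟩ h
    · exact hanti.antitoneOn (Set.self_mem_Ici) h h
  · rw [div_eq_iff (G2_pos hc).ne', deriv_G1_div_deriv_G2 hν1 hν2 hc]
    rw [auxH] at hzero
    linarith
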